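/- Assume Ψ satisfies the SOSC with feasible open set O, let s be the similarity dimension, let μ be the natural measure, and assume μ(∂O) = 0 and that μ gives zero measure to every sphere in ℝⁿ (known properties under the SOSC). Let m and M be the infimum and supremum of θ_μ^s(x, d) over typical balls B(x, d), and suppose there exist typical balls B(x₁, d₁) and B(x₂, d₂) with θ_μ^s(x₁, d₁) = m and θ_μ^s(x₂, d₂) = M. Then {θ_μ^s(x, d) : B(x, d) a typical ball} = Spec(μ, O ∩ E) = [m, M]. -/

import Mathlib

open MeasureTheory Filter Topology
open scoped ENNReal

noncomputable section

/-- `f` is a similarity of ratio `r`. -/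
def IsSimilarityRatio {X : Type*} [MetricSpace X] (f : X → X) (r : ℝ) : Prop :=
  ∀ x y, dist (f x) (f y) = r * dist x y

/-- The `s`-density `θ_μ^s(x, d) = μ(B(x,d)) / (2d)^s` of the closed ball `B(x, d)`. -/
def sdens {n : ℕ} (μ : Measure (EuclideanSpace ℝ (Fin n))) (s : ℝ)
    (x : EuclideanSpace ℝ (Fin n)) (d : ℝ) : ℝ≥0∞ :=
  μ (Metric.closedBall x d) / ENNReal.ofReal ((2 * d) ^ s)

/-- The asymptotic spectrum `Spec(μ, x)`. -/
def specAt {n : ℕ} (μ : Measure (EuclideanSpace ℝ (Fin n))) (s : ℝ)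
    (x : EuclideanSpace ℝ (Fin n)) : Set ℝ≥0∞ :=
  {L | ∃ d : ℕ → ℝ, (∀ k, 0 < d k) ∧ Tendsto d atTop (nhds 0) ∧
    Tendsto (fun k => sdens μ s x (d k)) atTop (nhds L)}

/-- The set of `s`-densities of typical balls: `Im(θ_μ^s, 𝓑)`. -/
def typDens {n : ℕ} (μ : Measure (EuclideanSpace ℝ (Fin n))) (s : ℝ)
    (E O : Set (EuclideanSpace ℝ (Fin n))) : Set ℝ≥0∞ :=
  {t | ∃ x ∈ E, ∃ d : ℝ, 0 < d ∧ Metric.closedBall x d ⊆ O ∧ t = sdens μ s x d}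

namespace IsSimilarityRatio

variable {X : Type*} [MetricSpace X] {g h : X → X} {ρ σ : ℝ}

lemma comp (hg : IsSimilarityRatio g ρ) (hh : IsSimilarityRatio h σ) :
    IsSimilarityRatio (g ∘ h) (ρ * σ) := fun x y => by
  rw [Function.comp_apply, Function.comp_apply, hg, hh, mul_assoc]

lemma continuous (hg : IsSimilarityRatio g ρ) (hρ : 0 < ρ) : Continuous g :=
  (LipschitzWith.of_dist_le_mul (K := ⟨ρ, hρ.le⟩) fun x y => (hg x y).le).continuous

lemma preimage_closedBall (hg : IsSimilarityRatio g ρ) (hρ : 0 < ρ) (x : X) (d : ℝ) :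
    g ⁻¹' Metric.closedBall (g x) (ρ * d) = Metric.closedBall x d := by
  ext y
  simp [hg y x, hρ]

lemma surjective {V : Type*} [NormedAddCommGroup V] [InnerProductSpace ℝ V]
    [FiniteDimensional ℝ V] {g : V → V} (hg : IsSimilarityRatio g ρ) (hρ : 0 < ρ) :
    Function.Surjective g := by
  have hiso : Isometry fun x => ρ⁻¹ • g x := Isometry.of_dist_eq fun x y => by
    rw [dist_smul₀, hg, Real.norm_of_nonneg (inv_pos.2 hρ).le, inv_mul_cancel_left₀ hρ.ne']
  intro y
  have : Inhabited V := ⟨0⟩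
  obtain ⟨x, hx⟩ :=
    (hiso.affineIsometryOfStrictConvexSpace.toAffineIsometryEquiv rfl).surjective (ρ⁻¹ • y)
  exact ⟨x, smul_right_injective V (inv_ne_zero hρ.ne') hx⟩

end IsSimilarityRatio

/-- `IsWordMap f r g ρ` says that `g` is a finite composition of the maps `f i` and that `ρ` is
the product of the corresponding `r i`. -/
inductive IsWordMap {ι X : Type*} (f : ι → X → X) (r : ι → ℝ) : (X → X) → ℝ → Prop
  | id : IsWordMap f r id 1
  | cons (i : ι) {g : X → X} {ρ : ℝ} (hg : IsWordMap f r g ρ) :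
      IsWordMap f r (f i ∘ g) (r i * ρ)

namespace IsWordMap

variable {ι X : Type*} {f : ι → X → X} {r : ι → ℝ} {g h : X → X} {ρ σ : ℝ}

lemma comp (hg : IsWordMap f r g ρ) (hh : IsWordMap f r h σ) :
    IsWordMap f r (g ∘ h) (ρ * σ) := by
  induction hg with
  | id => simpa using hh
  | cons i _ ih => simpa only [mul_assoc, Function.comp_assoc] using ih.cons i

lemma pos (hg : IsWordMap f r g ρ) (hr : ∀ i, 0 < r i) : 0 < ρ := by
  induction hg with
  | id => exact one_pos
  | cons i _ ih => exact mul_pos (hr i) ih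

lemma isSimilarityRatio [MetricSpace X] (hg : IsWordMap f r g ρ)
    (hf : ∀ i, IsSimilarityRatio (f i) (r i)) : IsSimilarityRatio g ρ := by
  induction hg with
  | id => exact fun x y => (one_mul _).symm
  | cons i _ ih => exact (hf i).comp ih

lemma mapsTo (hg : IsWordMap f r g ρ) {A : Set X} (hf : ∀ i, Set.MapsTo (f i) A A) :
    Set.MapsTo g A A := by
  induction hg with
  | id => exact Set.mapsTo_id A
  | cons i _ ih => exact (hf i).comp ih

lemma exists_lt_of_mem [Finite ι] (hr : ∀ i, r i ∈ Set.Ioo (0 : ℝ) 1) {E : Set X}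
    (hE : E = ⋃ i, f i '' E) {x : X} (hx : x ∈ E) {ε : ℝ} (hε : 0 < ε) :
    ∃ g ρ, IsWordMap f r g ρ ∧ ρ < ε ∧ x ∈ g '' E := by
  obtain ⟨i₀, -⟩ := Set.mem_iUnion.1 (hE ▸ hx)
  have : Nonempty ι := ⟨i₀⟩
  obtain ⟨j, hj⟩ := Finite.exists_max r
  have key : ∀ N : ℕ, ∀ x ∈ E, ∃ g ρ, IsWordMap f r g ρ ∧ ρ ≤ r j ^ N ∧ x ∈ g '' E := by
    intro N
    induction N with
    | zero => exact fun x hx => ⟨_, _, .id, by simp, by simpa using hx⟩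
    | succ N ih =>
      intro x hx
      rw [hE] at hx
      obtain ⟨i, e, he, rfl⟩ := Set.mem_iUnion.1 hx
      obtain ⟨g, ρ, hg, hρ, hmem⟩ := ih e he
      refine ⟨_, _, hg.cons i, ?_, ?_⟩
      · rw [pow_succ']
        exact mul_le_mul (hj i) hρ (hg.pos fun i => (hr i).1).le (hr j).1.le
      · rw [Set.image_comp]
        exact Set.mem_image_of_mem _ hmem
  obtain ⟨N, hN⟩ := exists_pow_lt_of_lt_one hε (hr j).2
  obtain ⟨g, ρ, hg, hρ, hmem⟩ := key N x hx
  exact ⟨g, ρ, hg, hρ.trans_lt hN, hmem⟩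

end IsWordMap

lemma mapsTo_of_eq_iUnion_image {ι X : Type*} {f : ι → X → X} {E : Set X}
    (hE : E = ⋃ i, f i '' E) (i : ι) : Set.MapsTo (f i) E E := fun x hx => by
  rw [hE]
  exact Set.mem_iUnion.2 ⟨i, x, hx, rfl⟩

section Attractor

variable {ι X : Type*} [MetricSpace X] {f : ι → X → X} {r : ι → ℝ} {E O : Set X}


lemma IsWordMap.exists_image_subset_ball [Finite ι] (hr : ∀ i, r i ∈ Set.Ioo (0 : ℝ) 1)
    (hf : ∀ i, IsSimilarityRatio (f i) (r i)) (hEc : IsCompact E) (hE : E = ⋃ i, f i '' E)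
    {x : X} (hx : x ∈ E) {ε : ℝ} (hε : 0 < ε) :
    ∃ g ρ, IsWordMap f r g ρ ∧ ρ < ε ∧ ∀ e ∈ E, dist (g e) x < ε := by
  have hD : 0 < Metric.diam E + 1 := by positivity
  obtain ⟨g, ρ, hg, hρ, e₀, he₀, rfl⟩ :=
    IsWordMap.exists_lt_of_mem hr hE hx (div_pos hε hD)
  have hpos := hg.pos fun i => (hr i).1
  refine ⟨g, ρ, hg, hρ.trans_le (div_le_self hε.le (by simp [Metric.diam_nonneg])), fun e he => ?_⟩
  rw [hg.isSimilarityRatio hf]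
  rw [lt_div_iff₀ hD] at hρ
  have := Metric.dist_le_diam_of_mem hEc.isBounded he he₀
  nlinarith

lemma attractor_subset_closure [Finite ι] (hr : ∀ i, r i ∈ Set.Ioo (0 : ℝ) 1)
    (hf : ∀ i, IsSimilarityRatio (f i) (r i)) (hEc : IsCompact E) (hE : E = ⋃ i, f i '' E)
    (hO : ∀ i, Set.MapsTo (f i) O O) (hOE : (O ∩ E).Nonempty) : E ⊆ closure O := by
  intro x hx
  obtain ⟨o, hoO, hoE⟩ := hOE
  refine Metric.mem_closure_iff.2 fun ε hε => ?_
  obtain ⟨g, ρ, hg, -, hgx⟩ := IsWordMap.exists_image_subset_ball hr hf hEc hE hx hε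
  exact ⟨g o, hg.mapsTo hO hoO, by rw [dist_comm]; exact hgx o hoE⟩

/-- Some point `y` of the attractor returns, under expansion by the inverses of longer and longer
word maps, arbitrarily close to a prescribed point `x` of the attractor. -/
lemma exists_recurrent [Finite ι] (hr : ∀ i, r i ∈ Set.Ioo (0 : ℝ) 1)
    (hf : ∀ i, IsSimilarityRatio (f i) (r i)) (hEc : IsCompact E) (hE : E = ⋃ i, f i '' E)
    {x : X} (hx : x ∈ E) {ε : ℝ} (hε : 0 < ε) :
    ∃ y ∈ E, dist y x < ε ∧ ∃ (G : ℕ → X → X) (R : ℕ → ℝ) (z : ℕ → X),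
      (∀ k, IsWordMap f r (G k) (R k)) ∧ Tendsto R atTop (𝓝 0) ∧ Tendsto z atTop (𝓝 x) ∧
      ∀ k, G k (z k) = y := by
  have hr0 : ∀ i, 0 < r i := fun i => (hr i).1
  let δ : ℕ → ℝ := fun k => min ε 1 * (1 / 2) ^ k
  have hδ : ∀ k, 0 < δ k := fun k => by positivity
  choose g ρ hg hρ hgx using fun k =>
    IsWordMap.exists_image_subset_ball hr hf hEc hE hx (hδ (k + 1))
  let G : ℕ → X → X := fun k => Nat.rec id (fun j F => F ∘ g j) k
  let R : ℕ → ℝ := fun k => Nat.rec 1 (fun j a => a * ρ j) k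
  have hG : ∀ k, IsWordMap f r (G k) (R k) := by
    intro k
    induction k with
    | zero => exact .id
    | succ k ih => exact ih.comp (hg k)
  have hR : ∀ k, R k ≤ (1 / 2) ^ k := by
    intro k
    induction k with
    | zero => simp [R]
    | succ k ih =>
      have h2 : ρ k ≤ 1 / 2 := (hρ k).le.trans <| by
        have h3 : min ε 1 ≤ 1 := min_le_right _ _
        have h4 : ((1 : ℝ) / 2) ^ k ≤ 1 := pow_le_one₀ (by norm_num) (by norm_num)
        have h5 : (0 : ℝ) < (1 / 2) ^ k := by positivity
        simp only [δ, pow_succ]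
        nlinarith
      rw [pow_succ]
      exact mul_le_mul ih h2 ((hg k).pos hr0).le (by positivity)
  have hmapE : ∀ i, Set.MapsTo (f i) E E := mapsTo_of_eq_iUnion_image hE
  obtain ⟨y, hy⟩ := IsCompact.nonempty_iInter_of_sequence_nonempty_isCompact_isClosed
    (fun k => G k '' E)
    (fun k => by
      change (G k ∘ g k) '' E ⊆ _
      rw [Set.image_comp]
      exact Set.image_mono ((hg k).mapsTo hmapE).image_subset)
    (fun k => ⟨_, Set.mem_image_of_mem _ hx⟩)
    (hEc.image (((hG 0).isSimilarityRatio hf).continuous ((hG 0).pos hr0)))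
    (fun k => (hEc.image (((hG k).isSimilarityRatio hf).continuous ((hG k).pos hr0))).isClosed)
  choose e he hey using fun k => Set.mem_iInter.1 hy (k + 1)
  have hz : ∀ k, dist (g k (e k)) x < δ (k + 1) := fun k => hgx k _ (he k)
  have hhalf : Tendsto (fun k : ℕ => ((1 : ℝ) / 2) ^ k) atTop (𝓝 0) :=
    tendsto_pow_atTop_nhds_zero_of_lt_one (by norm_num) (by norm_num)
  have hδlim : Tendsto δ atTop (𝓝 0) := by
    simpa only [mul_zero] using hhalf.const_mul (min ε 1)
  have hy0 : g 0 (e 0) = y := hey 0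
  refine ⟨y, hy0 ▸ (hg 0).mapsTo hmapE (he 0), ?_, G, R, fun k => g k (e k), hG, ?_, ?_, hey⟩
  · rw [← hy0]
    refine (hz 0).trans ?_
    have : min ε 1 ≤ ε := min_le_left _ _
    simp only [δ]
    linarith
  · exact squeeze_zero (fun k => ((hG k).pos hr0).le) hR hhalf
  · exact tendsto_iff_dist_tendsto_zero.2 <| squeeze_zero (fun _ => dist_nonneg)
      (fun k => (hz k).le) ((tendsto_add_atTop_iff_nat 1).2 hδlim)

end Attractor

lemma eventually_nhds_closedBall_subset {X : Type*} [NormedAddCommGroup X] [NormedSpace ℝ X]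
    [ProperSpace X] {O : Set X} (hO : IsOpen O) {x : X} {d : ℝ} (hd : 0 < d)
    (hxd : Metric.closedBall x d ⊆ O) : ∀ᶠ z in 𝓝 x, Metric.closedBall z d ⊆ O := by
  obtain ⟨ε, hε, hsub⟩ := (isCompact_closedBall x d).exists_cthickening_subset_open hO hxd
  rw [cthickening_closedBall hε.le hd.le] at hsub
  filter_upwards [Metric.closedBall_mem_nhds x hε] with z hz
  exact (Metric.closedBall_subset_closedBall' (by
    have := Metric.mem_closedBall.1 hz
    linarith)).trans hsub

section Density

variable {n : ℕ} {μ : Measure (EuclideanSpace ℝ (Fin n))} {s : ℝ}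
  {E O : Set (EuclideanSpace ℝ (Fin n))}

lemma continuous_measure_closedBall [IsFiniteMeasure μ]
    (hsph : ∀ (z : EuclideanSpace ℝ (Fin n)) (ρ : ℝ), μ (Metric.sphere z ρ) = 0) :
    Continuous fun p : EuclideanSpace ℝ (Fin n) × ℝ => μ (Metric.closedBall p.1 p.2) := by
  refine continuous_iff_continuousAt.2 fun p => ?_
  refine tendsto_measure_of_ae_tendsto_indicator_of_isFiniteMeasure (𝓝 p)
    Metric.isClosed_closedBall.measurableSet (fun q => Metric.isClosed_closedBall.measurableSet) ?_
  have hne : ∀ᵐ x ∂μ, x ∉ Metric.sphere p.1 p.2 := measure_eq_zero_iff_ae_notMem.1 (hsph _ _)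
  filter_upwards [hne] with x hx
  have hc : Continuous fun q : EuclideanSpace ℝ (Fin n) × ℝ => dist x q.1 := by fun_prop
  rcases lt_or_gt_of_ne (show dist x p.1 ≠ p.2 from hx) with h | h
  · filter_upwards [hc.continuousAt.eventually_lt continuous_snd.continuousAt h] with q hq
    exact iff_of_true hq.le h.le
  · filter_upwards [continuous_snd.continuousAt.eventually_lt hc.continuousAt h] with q hq
    exact iff_of_false hq.not_ge h.not_ge

lemma continuousAt_sdens [IsFiniteMeasure μ]
    (hsph : ∀ (z : EuclideanSpace ℝ (Fin n)) (ρ : ℝ), μ (Metric.sphere z ρ) = 0)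
    {p : EuclideanSpace ℝ (Fin n) × ℝ} (hp : 0 < p.2) :
    ContinuousAt (fun p : EuclideanSpace ℝ (Fin n) × ℝ => sdens μ s p.1 p.2) p := by
  refine ENNReal.Tendsto.div (continuous_measure_closedBall hsph).continuousAt (.inr ?_)
    (ENNReal.tendsto_ofReal ?_) (.inr (measure_ne_top _ _))
  · exact (ENNReal.ofReal_pos.2 (by positivity)).ne'
  · exact (continuous_snd.const_mul (2 : ℝ)).continuousAt.rpow_const (.inl (by positivity))

lemma continuousAt_sdens_center [IsFiniteMeasure μ]
    (hsph : ∀ (z : EuclideanSpace ℝ (Fin n)) (ρ : ℝ), μ (Metric.sphere z ρ) = 0)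
    (x : EuclideanSpace ℝ (Fin n)) {d : ℝ} (hd : 0 < d) :
    ContinuousAt (fun z => sdens μ s z d) x :=
  ContinuousAt.comp (f := fun z => (z, d)) (x := x) (continuousAt_sdens hsph (p := (x, d)) hd)
    (by fun_prop)

lemma continuousAt_sdens_radius [IsFiniteMeasure μ]
    (hsph : ∀ (z : EuclideanSpace ℝ (Fin n)) (ρ : ℝ), μ (Metric.sphere z ρ) = 0)
    (x : EuclideanSpace ℝ (Fin n)) {d : ℝ} (hd : 0 < d) :
    ContinuousAt (fun d => sdens μ s x d) d :=
  ContinuousAt.comp (f := fun d => (x, d)) (x := d) (continuousAt_sdens hsph (p := (x, d)) hd)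
    (by fun_prop)

lemma measure_compl_eq_zero_of_subset_closure (hO : IsOpen O) (hsupp : μ Eᶜ = 0)
    (hE : E ⊆ closure O) (hfront : μ (frontier O) = 0) : μ Oᶜ = 0 := by
  refine measure_mono_null (fun x hx => ?_) (measure_union_null hsupp hfront)
  rw [hO.frontier_eq]
  by_cases hxE : x ∈ E
  · exact .inr ⟨hE hxE, hx⟩
  · exact .inl hxE

variable {ι : Type*} [Fintype ι]
  {f : ι → EuclideanSpace ℝ (Fin n) → EuclideanSpace ℝ (Fin n)} {r : ι → ℝ}

lemma measure_closedBall_map (hr : ∀ i, 0 < r i) (hf : ∀ i, IsSimilarityRatio (f i) (r i))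
    (hOdisj : ∀ i j, i ≠ j → Disjoint (f i '' O) (f j '' O)) (hOnull : μ Oᶜ = 0)
    (hinv : μ = ∑ i, ENNReal.ofReal ((r i) ^ s) • μ.map (f i)) (i : ι)
    {x : EuclideanSpace ℝ (Fin n)} {d : ℝ} (hxd : Metric.closedBall x d ⊆ O) :
    μ (Metric.closedBall (f i x) (r i * d)) =
      ENNReal.ofReal ((r i) ^ s) * μ (Metric.closedBall x d) := by
  have hpre := (hf i).preimage_closedBall (hr i) x d
  have himg : Metric.closedBall (f i x) (r i * d) ⊆ f i '' O := by
    rw [← Set.image_preimage_eq (Metric.closedBall _ _) ((hf i).surjective (hr i)), hpre]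
    exact Set.image_mono hxd
  conv_lhs => rw [hinv]
  rw [Measure.finsetSum_apply, Finset.sum_eq_single_of_mem i (Finset.mem_univ i)]
  · rw [Measure.smul_apply, Measure.map_apply ((hf i).continuous (hr i)).measurable
      Metric.isClosed_closedBall.measurableSet, hpre, smul_eq_mul]
  · intro j _ hji
    rw [Measure.smul_apply, Measure.map_apply ((hf j).continuous (hr j)).measurable
      Metric.isClosed_closedBall.measurableSet, smul_eq_mul]
    refine mul_eq_zero_of_right _ (measure_mono_null (t := Oᶜ) ?_ hOnull)
    intro y hy hyO
    exact Set.disjoint_left.1 (hOdisj j i hji) (Set.mem_image_of_mem _ hyO) (himg hy)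

lemma IsWordMap.sdens_map {g : EuclideanSpace ℝ (Fin n) → EuclideanSpace ℝ (Fin n)} {ρ : ℝ}
    (hg : IsWordMap f r g ρ) (hr : ∀ i, 0 < r i) (hf : ∀ i, IsSimilarityRatio (f i) (r i))
    (hO : ∀ i, Set.MapsTo (f i) O O)
    (hOdisj : ∀ i j, i ≠ j → Disjoint (f i '' O) (f j '' O)) (hOnull : μ Oᶜ = 0)
    (hinv : μ = ∑ i, ENNReal.ofReal ((r i) ^ s) • μ.map (f i))
    {x : EuclideanSpace ℝ (Fin n)} {d : ℝ} (hd : 0 < d) (hxd : Metric.closedBall x d ⊆ O) :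
    Metric.closedBall (g x) (ρ * d) ⊆ O ∧ sdens μ s (g x) (ρ * d) = sdens μ s x d := by
  induction hg with
  | id => simpa using hxd
  | @cons i g ρ hg ih =>
    obtain ⟨hsub, hdens⟩ := ih
    have hρd : 0 < ρ * d := mul_pos (hg.pos hr) hd
    rw [Function.comp_apply, mul_assoc]
    constructor
    · rw [← Set.image_preimage_eq (Metric.closedBall _ _) ((hf i).surjective (hr i)),
        (hf i).preimage_closedBall (hr i)]
      exact (Set.image_mono hsub).trans (hO i).image_subset
    · have hri : 0 < r i ^ s := Real.rpow_pos_of_pos (hr i) s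
      rw [← hdens, sdens, sdens, measure_closedBall_map hr hf hOdisj hOnull hinv i hsub,
        mul_left_comm, Real.mul_rpow (hr i).le (by positivity), ENNReal.ofReal_mul hri.le,
        ENNReal.mul_div_mul_left _ _ (ENNReal.ofReal_pos.2 hri).ne' ENNReal.ofReal_ne_top]

lemma sdens_mem_specAt_of_recurrent [IsFiniteMeasure μ] (hr : ∀ i, r i ∈ Set.Ioo (0 : ℝ) 1)
    (hf : ∀ i, IsSimilarityRatio (f i) (r i)) (hEc : IsCompact E) (hE : E = ⋃ i, f i '' E)
    (hOopen : IsOpen O) (hO : ∀ i, Set.MapsTo (f i) O O)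
    (hOdisj : ∀ i j, i ≠ j → Disjoint (f i '' O) (f j '' O)) (hOnull : μ Oᶜ = 0)
    (hinv : μ = ∑ i, ENNReal.ofReal ((r i) ^ s) • μ.map (f i))
    (hsph : ∀ (z : EuclideanSpace ℝ (Fin n)) (ρ : ℝ), μ (Metric.sphere z ρ) = 0)
    {x : EuclideanSpace ℝ (Fin n)} (hx : x ∈ E) {d : ℝ} (hd : 0 < d)
    (hxd : Metric.closedBall x d ⊆ O) : ∃ y ∈ O ∩ E, sdens μ s x d ∈ specAt μ s y := by
  have hr0 : ∀ i, 0 < r i := fun i => (hr i).1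
  obtain ⟨y, hyE, hyx, G, R, z, hG, hR, hz, hGz⟩ := exists_recurrent hr hf hEc hE hx hd
  refine ⟨y, ⟨hxd hyx.le, hyE⟩, fun k => R k * d, fun k => mul_pos ((hG k).pos hr0) hd,
    by simpa using hR.mul_const d, ?_⟩
  have hlim : Tendsto (fun k => sdens μ s (z k) d) atTop (𝓝 (sdens μ s x d)) :=
    (continuousAt_sdens_center hsph x hd).tendsto.comp hz
  refine hlim.congr' ?_
  filter_upwards [hz.eventually (eventually_nhds_closedBall_subset hOopen hd hxd)] with k hk
  rw [← hGz k]
  exact ((hG k).sdens_map hr0 hf hO hOdisj hOnull hinv hd hk).2.symm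

lemma ordConnected_typDens [IsFiniteMeasure μ] (hr : ∀ i, r i ∈ Set.Ioo (0 : ℝ) 1)
    (hf : ∀ i, IsSimilarityRatio (f i) (r i)) (hEc : IsCompact E) (hE : E = ⋃ i, f i '' E)
    (hOopen : IsOpen O) (hO : ∀ i, Set.MapsTo (f i) O O)
    (hOdisj : ∀ i j, i ≠ j → Disjoint (f i '' O) (f j '' O)) (hOnull : μ Oᶜ = 0)
    (hinv : μ = ∑ i, ENNReal.ofReal ((r i) ^ s) • μ.map (f i))
    (hsph : ∀ (z : EuclideanSpace ℝ (Fin n)) (ρ : ℝ), μ (Metric.sphere z ρ) = 0) :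
    (typDens μ s E O).OrdConnected := by
  have hr0 : ∀ i, 0 < r i := fun i => (hr i).1
  refine ⟨fun a ha b hb t ht => ?_⟩
  rcases ht.1.eq_or_lt with rfl | hat
  · exact ha
  obtain ⟨x₁, hx₁, d₁, hd₁, hsub₁, rfl⟩ := ha
  obtain ⟨x₂, hx₂, d₂, hd₂, hsub₂, rfl⟩ := hb
  obtain ⟨ε, hε, hball⟩ := Metric.eventually_nhds_iff.1
    (((continuousAt_sdens_center hsph x₁ hd₁).eventually_lt_const hat).and
      (eventually_nhds_closedBall_subset hOopen hd₁ hsub₁))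
  obtain ⟨g, ρ, hg, -, hgx⟩ := IsWordMap.exists_image_subset_ball hr hf hEc hE hx₁ hε
  obtain ⟨hlt, hsub⟩ := hball (hgx x₂ hx₂)
  obtain ⟨hsub', hdens⟩ := hg.sdens_map hr0 hf hO hOdisj hOnull hinv hd₂ hsub₂
  have hρd : 0 < ρ * d₂ := mul_pos (hg.pos hr0) hd₂
  have hpos : ∀ d ∈ Set.uIcc d₁ (ρ * d₂), 0 < d := fun d hd => (lt_min hd₁ hρd).trans_le hd.1
  have hcontOn : ContinuousOn (fun d => sdens μ s (g x₂) d) (Set.uIcc d₁ (ρ * d₂)) :=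
    fun d hd => (continuousAt_sdens_radius hsph (g x₂) (hpos d hd)).continuousWithinAt
  obtain ⟨d, hd, hdt⟩ := intermediate_value_uIcc hcontOn
    (Set.Icc_subset_uIcc ⟨hlt.le, hdens ▸ ht.2⟩)
  refine ⟨g x₂, hg.mapsTo (mapsTo_of_eq_iUnion_image hE) hx₂, d, hpos d hd, ?_, hdt.symm⟩
  rcases le_max_iff.1 hd.2 with h | h
  · exact (Metric.closedBall_subset_closedBall h).trans hsub
  · exact (Metric.closedBall_subset_closedBall h).trans hsub'

lemma specAt_subset_Icc (hOopen : IsOpen O) {x : EuclideanSpace ℝ (Fin n)} (hxO : x ∈ O)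
    (hxE : x ∈ E) :
    specAt μ s x ⊆ Set.Icc (sInf (typDens μ s E O)) (sSup (typDens μ s E O)) := by
  rintro L ⟨d, hd, hd0, hL⟩
  obtain ⟨ε, hε, hsub⟩ := Metric.nhds_basis_closedBall.mem_iff.1 (hOopen.mem_nhds hxO)
  have hmem : ∀ᶠ k in atTop, sdens μ s x (d k) ∈ typDens μ s E O := by
    filter_upwards [hd0.eventually_le_const hε] with k hk
    exact ⟨x, hxE, d k, hd k, (Metric.closedBall_subset_closedBall hk).trans hsub, rfl⟩
  exact ⟨ge_of_tendsto hL (hmem.mono fun k hk => sInf_le hk),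
    le_of_tendsto hL (hmem.mono fun k hk => le_sSup hk)⟩

end Density

/-- if moreover the infimum `m` and the supremum `M` of the densities of
typical balls are attained by typical balls, then
`Im(θ_μ^s, 𝓑) = Spec(μ, O ∩ E) = [m, M]`. -/
theorem stmt12 {n m : ℕ} (hn : 1 ≤ n) (hm : 2 ≤ m)
    (f : Fin m → EuclideanSpace ℝ (Fin n) → EuclideanSpace ℝ (Fin n))
    (r : Fin m → ℝ) (hr : ∀ i, r i ∈ Set.Ioo (0 : ℝ) 1)
    (hsim : ∀ i, IsSimilarityRatio (f i) (r i))
    (E : Set (EuclideanSpace ℝ (Fin n))) (hEcomp : IsCompact E) (hEne : E.Nonempty)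
    (hEattr : E = ⋃ i, f i '' E)
    (O : Set (EuclideanSpace ℝ (Fin n))) (hOopen : IsOpen O) (hOne : O.Nonempty)
    (hOmap : ∀ i, f i '' O ⊆ O)
    (hOdisj : ∀ i j, i ≠ j → Disjoint (f i '' O) (f j '' O))
    (hOE : (O ∩ E).Nonempty)
    (s : ℝ) (hs : ∑ i, (r i) ^ s = 1)
    (μ : Measure (EuclideanSpace ℝ (Fin n))) (hprob : IsProbabilityMeasure μ)
    (hsupp : μ Eᶜ = 0)
    (hinv : μ = ∑ i, ENNReal.ofReal ((r i) ^ s) • μ.map (f i))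
    (hfront : μ (frontier O) = 0)
    (hsph : ∀ (z : EuclideanSpace ℝ (Fin n)) (ρ : ℝ), μ (Metric.sphere z ρ) = 0)
    (hinfmem : sInf (typDens μ s E O) ∈ typDens μ s E O)
    (hsupmem : sSup (typDens μ s E O) ∈ typDens μ s E O) :
    typDens μ s E O = ⋃ x ∈ O ∩ E, specAt μ s x ∧
    typDens μ s E O = Set.Icc (sInf (typDens μ s E O)) (sSup (typDens μ s E O)) := by
  have hO : ∀ i, Set.MapsTo (f i) O O := fun i => Set.mapsTo_iff_image_subset.2 (hOmap i)
  have hOnull : μ Oᶜ = 0 := measure_compl_eq_zero_of_subset_closure hOopen hsupp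
    (attractor_subset_closure hr hsim hEcomp hEattr hO hOE) hfront
  have hIcc : typDens μ s E O = Set.Icc (sInf (typDens μ s E O)) (sSup (typDens μ s E O)) :=
    Set.Subset.antisymm (fun t ht => ⟨sInf_le ht, le_sSup ht⟩)
      ((ordConnected_typDens hr hsim hEcomp hEattr hOopen hO hOdisj hOnull hinv hsph).out
        hinfmem hsupmem)
  refine ⟨Set.Subset.antisymm ?_ ?_, hIcc⟩
  · rintro t ⟨x, hx, d, hd, hsub, rfl⟩
    obtain ⟨y, hy, hmem⟩ := sdens_mem_specAt_of_recurrent hr hsim hEcomp hEattr hOopen hO hOdisj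
      hOnull hinv hsph hx hd hsub
    exact Set.mem_biUnion hy hmem
  · rw [hIcc]
    exact Set.iUnion₂_subset fun x hx => specAt_subset_Icc hOopen hx.1 hx.2
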